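/- With the probability setup as above, P(U_{d,r} | V_{d,r}) = 1/((1+q^r)(1+q^{d-r})(1+q^d) · g₃(-q^r; q^d)), where V_{d,r} imposes the same gap conditions as U_{d,r} but only starting from index d+r (no restriction on E_r, E_{d-r}, E_d). -/

import Mathlib

open scoped BigOperators
open MeasureTheory ProbabilityTheory

/-- The real finite q-Pochhammer symbol `(a; q)_n`. -/
noncomputable def qPochR (a q : ℝ) (n : ℕ) : ℝ := ∏ j ∈ Finset.range n, (1 - a * q ^ j)

/-- Hickerson's universal mock theta function (real arguments). -/
noncomputable def g3R (x q : ℝ) : ℝ :=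
  ∑' n : ℕ, q ^ (n * (n + 1)) / (qPochR x q (n + 1) * qPochR (x⁻¹ * q) q (n + 1))

section Analysis

open Filter Topology

/-- Two bounded solutions of a second-order linear recurrence whose trailing coefficient is
dominated by its leading coefficient are proportional. -/
lemma bounded_solutions_proportional {h p c e δ : ℕ → ℝ} {Q B : ℝ} (hQ0 : 0 ≤ Q) (hQ1 : Q < 1)
    (hδ : ∀ n, 0 < δ n) (he : ∀ n, |e n| ≤ Q * δ n)
    (hh : ∀ n, δ n * h n = c n * h (n + 1) + e n * h (n + 2))
    (hp : ∀ n, δ n * p n = c n * p (n + 1) + e n * p (n + 2))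
    (hhB : ∀ n, |h n| ≤ B) (hpB : ∀ n, |p n| ≤ B) :
    h 0 * p 1 = h 1 * p 0 := by
  set W : ℕ → ℝ := fun n => h n * p (n + 1) - h (n + 1) * p n with hW
  have hB : 0 ≤ B := (abs_nonneg _).trans (hhB 0)
  have step : ∀ n, |W n| ≤ Q * |W (n + 1)| := by
    intro n
    have h1 : δ n * W n = -(e n * W (n + 1)) := by
      simp only [hW]
      linear_combination p (n + 1) * hh n - h (n + 1) * hp n
    have h2 : δ n * |W n| = |e n| * |W (n + 1)| := by
      rw [← abs_mul, ← abs_neg (e n * _), ← h1, abs_mul, abs_of_pos (hδ n)]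
    refine le_of_mul_le_mul_left ?_ (hδ n)
    rw [h2]
    calc |e n| * |W (n + 1)| ≤ (Q * δ n) * |W (n + 1)| := by gcongr; exact he n
      _ = δ n * (Q * |W (n + 1)|) := by ring
  have iter : ∀ n, |W 0| ≤ Q ^ n * |W n| := by
    intro n
    induction n with
    | zero => simp
    | succ n ih =>
      calc |W 0| ≤ Q ^ n * |W n| := ih
        _ ≤ Q ^ n * (Q * |W (n + 1)|) := by gcongr; exact step n
        _ = Q ^ (n + 1) * |W (n + 1)| := by ring
  have bd : ∀ n, |W n| ≤ B * B + B * B := by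
    intro n
    refine (abs_sub _ _).trans ?_
    rw [abs_mul, abs_mul]
    gcongr <;> first | exact hhB _ | exact hpB _
  have lim : Tendsto (fun n => Q ^ n * (B * B + B * B)) atTop (𝓝 0) := by
    simpa using (tendsto_pow_atTop_nhds_zero_of_lt_one hQ0 hQ1).mul_const (B * B + B * B)
  have h0 : |W 0| ≤ 0 := ge_of_tendsto' lim fun n =>
    (iter n).trans (mul_le_mul_of_nonneg_left (bd n) (pow_nonneg hQ0 n))
  have := abs_nonpos_iff.1 h0
  simp only [hW] at this
  linarith

/-- The factor `(1 + x Q^m) (1 + y Q^m)` for `x + y = s`, `x y = Q`. -/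
noncomputable def schurFactor (Q s : ℝ) (m : ℕ) : ℝ := 1 + s * Q ^ m + Q ^ (2 * m + 1)

/-- Summand of the series solution of the Schur recurrence. -/
noncomputable def schurTerm (Q s : ℝ) (n k : ℕ) : ℝ :=
  qPochR (Q ^ n) Q k / qPochR Q Q k * Q ^ (n * k + k ^ 2) /
    ∏ j ∈ Finset.range k, schurFactor Q s (n + j)

variable {Q s : ℝ}

lemma qPochR_succ (a q : ℝ) (n : ℕ) : qPochR a q (n + 1) = qPochR a q n * (1 - a * q ^ n) :=
  Finset.prod_range_succ _ _

lemma qPochR_succ_left (a q : ℝ) (n : ℕ) :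
    qPochR a q (n + 1) = (1 - a) * qPochR (a * q) q n := by
  simp only [qPochR]
  rw [Finset.prod_range_succ']
  simp only [pow_zero, mul_one]
  rw [mul_comm]
  congr 1
  exact Finset.prod_congr rfl fun j _ => by ring

lemma qPochR_self_pos (hQ0 : 0 < Q) (hQ1 : Q < 1) (k : ℕ) : 0 < qPochR Q Q k :=
  Finset.prod_pos fun j _ => by
    have : Q ^ (j + 1) < 1 := pow_lt_one₀ hQ0.le hQ1 (by omega)
    rw [pow_succ'] at this
    linarith

lemma qPochR_pow_mem_Icc (hQ0 : 0 < Q) (hQ1 : Q < 1) (n k : ℕ) :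
    qPochR (Q ^ n) Q k ∈ Set.Icc (0 : ℝ) 1 := by
  have h : ∀ j : ℕ, Q ^ n * Q ^ j ≤ 1 := fun j => by
    rw [← pow_add]; exact pow_le_one₀ hQ0.le hQ1.le
  refine ⟨Finset.prod_nonneg fun j _ => by linarith [h j],
    Finset.prod_le_one (fun j _ => by linarith [h j]) fun j _ => ?_⟩
  have : 0 < Q ^ n * Q ^ j := by positivity
  linarith

lemma one_le_schurFactor (hQ0 : 0 < Q) (hs : 0 ≤ s) (m : ℕ) : 1 ≤ schurFactor Q s m := by
  have h1 : 0 ≤ s * Q ^ m := by positivity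
  have h2 : 0 < Q ^ (2 * m + 1) := by positivity
  unfold schurFactor; linarith

lemma summable_pow_sq_div_qPochR (hQ0 : 0 < Q) (hQ1 : Q < 1) :
    Summable fun k : ℕ => Q ^ (k ^ 2) / qPochR Q Q k := by
  have lim : Tendsto (fun k : ℕ => Q ^ (2 * k + 1) / (1 - Q ^ (k + 1))) atTop (𝓝 0) := by
    have h := tendsto_pow_atTop_nhds_zero_of_lt_one hQ0.le hQ1
    have h1 : Tendsto (fun k : ℕ => Q ^ (2 * k + 1)) atTop (𝓝 0) :=
      h.comp (tendsto_atTop_mono (fun k => show k ≤ 2 * k + 1 by omega) tendsto_id)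
    have h2 : Tendsto (fun k : ℕ => Q ^ (k + 1)) atTop (𝓝 0) :=
      h.comp (tendsto_add_atTop_nat 1)
    have h3 := h1.div (h2.const_sub 1) (by norm_num)
    rwa [zero_div] at h3
  refine summable_of_ratio_test_tendsto_lt_one (l := 0) one_pos
    (Eventually.of_forall fun k => (div_pos (by positivity) (qPochR_self_pos hQ0 hQ1 k)).ne')
    (lim.congr fun k => ?_)
  have p1 := qPochR_self_pos hQ0 hQ1 k
  have p2 := qPochR_self_pos hQ0 hQ1 (k + 1)
  have p3 : Q ^ (k + 1) < 1 := pow_lt_one₀ hQ0.le hQ1 (by omega)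
  have p4 : 1 - Q ^ (k + 1) ≠ 0 := by linarith
  rw [Real.norm_of_nonneg (by positivity), Real.norm_of_nonneg (by positivity), qPochR_succ,
    ← pow_succ']
  field_simp
  ring

lemma schurTerm_nonneg (hQ0 : 0 < Q) (hQ1 : Q < 1) (hs : 0 ≤ s) (n k : ℕ) :
    0 ≤ schurTerm Q s n k := by
  have h1 := (qPochR_pow_mem_Icc hQ0 hQ1 n k).1
  have h2 := qPochR_self_pos hQ0 hQ1 k
  have h3 : 0 ≤ ∏ j ∈ Finset.range k, schurFactor Q s (n + j) :=
    Finset.prod_nonneg fun j _ => zero_le_one.trans (one_le_schurFactor hQ0 hs _)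
  unfold schurTerm; positivity

lemma schurTerm_le (hQ0 : 0 < Q) (hQ1 : Q < 1) (hs : 0 ≤ s) (n k : ℕ) :
    schurTerm Q s n k ≤ Q ^ (k ^ 2) / qPochR Q Q k := by
  have h1 := qPochR_pow_mem_Icc hQ0 hQ1 n k
  have h2 := qPochR_self_pos hQ0 hQ1 k
  have h3 : 1 ≤ ∏ j ∈ Finset.range k, schurFactor Q s (n + j) :=
    Finset.prod_induction _ (fun t => (1 : ℝ) ≤ t) (fun _ _ => one_le_mul_of_one_le_of_one_le)
      le_rfl fun j _ => one_le_schurFactor hQ0 hs _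
  have h4 : Q ^ (n * k + k ^ 2) ≤ Q ^ (k ^ 2) :=
    pow_le_pow_of_le_one hQ0.le hQ1.le (by omega)
  have h5 := h1.1
  unfold schurTerm
  calc _ ≤ qPochR (Q ^ n) Q k / qPochR Q Q k * Q ^ (n * k + k ^ 2) :=
        div_le_self (by positivity) h3
    _ ≤ 1 / qPochR Q Q k * Q ^ (k ^ 2) := by gcongr; exact h1.2
    _ = _ := by ring

lemma summable_schurTerm (hQ0 : 0 < Q) (hQ1 : Q < 1) (hs : 0 ≤ s) (n : ℕ) :
    Summable (schurTerm Q s n) :=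
  Summable.of_nonneg_of_le (schurTerm_nonneg hQ0 hQ1 hs n) (schurTerm_le hQ0 hQ1 hs n)
    (summable_pow_sq_div_qPochR hQ0 hQ1)

/-- Series solution of the Schur recurrence. -/
noncomputable def schurSeries (Q s : ℝ) (n : ℕ) : ℝ := ∑' k, schurTerm Q s n k

lemma abs_schurSeries_le (hQ0 : 0 < Q) (hQ1 : Q < 1) (hs : 0 ≤ s) (n : ℕ) :
    |schurSeries Q s n| ≤ ∑' k : ℕ, Q ^ (k ^ 2) / qPochR Q Q k := by
  unfold schurSeries
  rw [abs_of_nonneg (tsum_nonneg (schurTerm_nonneg hQ0 hQ1 hs n))]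
  exact (summable_schurTerm hQ0 hQ1 hs n).tsum_le_tsum (schurTerm_le hQ0 hQ1 hs n)
    (summable_pow_sq_div_qPochR hQ0 hQ1)

lemma schurSeries_zero : schurSeries Q s 0 = 1 := by
  unfold schurSeries
  rw [tsum_eq_single 0]
  · simp [schurTerm, qPochR]
  · intro k hk
    obtain ⟨k, rfl⟩ := Nat.exists_eq_succ_of_ne_zero hk
    simp [schurTerm, qPochR_succ_left]

lemma sum_schurTerm_recurrence (hQ0 : 0 < Q) (hQ1 : Q < 1) (hs : 0 ≤ s) (n K : ℕ) :
    ∑ k ∈ Finset.range (K + 1), (schurFactor Q s n * schurTerm Q s n k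
        - (1 + s * Q ^ n) * schurTerm Q s (n + 1) k)
      - Q ^ (n + 1) * (1 - Q ^ (n + 1)) / schurFactor Q s (n + 1) *
        ∑ k ∈ Finset.range K, schurTerm Q s (n + 2) k
      = Q ^ (2 * n + K + 1) * schurTerm Q s (n + 1) K := by
  have hδ : ∀ m, schurFactor Q s m ≠ 0 := fun m =>
    (zero_lt_one.trans_le (one_le_schurFactor hQ0 hs m)).ne'
  induction K with
  | zero =>
    simp [schurTerm, qPochR, schurFactor]
  | succ K ih =>
    rw [Finset.sum_range_succ _ (K + 1), Finset.sum_range_succ (fun k => schurTerm Q s (n + 2) k) K]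
    have p1 : (1 - Q ^ (K + 1)) ≠ 0 := by
      have : Q ^ (K + 1) < 1 := pow_lt_one₀ hQ0.le hQ1 (by omega)
      linarith
    have p2 : (1 - Q ^ (n + 1)) ≠ 0 := by
      have : Q ^ (n + 1) < 1 := pow_lt_one₀ hQ0.le hQ1 (by omega)
      linarith
    have p3 := (qPochR_self_pos hQ0 hQ1 K).ne'
    have e1 : qPochR (Q ^ n) Q (K + 1) = (1 - Q ^ n) * qPochR (Q ^ (n + 1)) Q K := by
      rw [qPochR_succ_left, pow_succ]
    have e2 : qPochR (Q ^ (n + 1)) Q (K + 1) =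
        qPochR (Q ^ (n + 1)) Q K * (1 - Q ^ (n + 1) * Q ^ K) := qPochR_succ _ _ _
    have e3 : qPochR (Q ^ (n + 2)) Q K =
        qPochR (Q ^ (n + 1)) Q K * (1 - Q ^ (n + 1) * Q ^ K) / (1 - Q ^ (n + 1)) := by
      rw [← qPochR_succ, qPochR_succ_left, ← pow_succ]
      field_simp
    have e4 : qPochR Q Q (K + 1) = qPochR Q Q K * (1 - Q ^ (K + 1)) := by
      rw [qPochR_succ, pow_succ']
    set D := ∏ j ∈ Finset.range K, schurFactor Q s (n + 1 + j) with hD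
    have hD0 : D ≠ 0 := Finset.prod_ne_zero_iff.2 fun j _ => hδ _
    have d1 : ∏ j ∈ Finset.range (K + 1), schurFactor Q s (n + j) = schurFactor Q s n * D := by
      rw [Finset.prod_range_succ', mul_comm, hD]
      congr 1
      exact Finset.prod_congr rfl fun j _ => by congr 1; omega
    have d2 : ∏ j ∈ Finset.range (K + 1), schurFactor Q s (n + 1 + j) =
        D * schurFactor Q s (n + 1 + K) := Finset.prod_range_succ _ _
    have d3 : ∏ j ∈ Finset.range K, schurFactor Q s (n + 2 + j) =
        D * schurFactor Q s (n + 1 + K) / schurFactor Q s (n + 1) := by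
      rw [← d2, Finset.prod_range_succ', eq_div_iff (hδ _)]
      congr 1
      exact Finset.prod_congr rfl fun j _ => by congr 1; omega
    have t1 : schurFactor Q s n * schurTerm Q s n (K + 1) =
        (1 - Q ^ n) * qPochR (Q ^ (n + 1)) Q K / (qPochR Q Q K * (1 - Q ^ (K + 1))) *
          Q ^ (n * (K + 1) + (K + 1) ^ 2) / D := by
      have := hδ n
      rw [schurTerm, d1, e1, e4]; field_simp
    have t2 : schurTerm Q s (n + 1) (K + 1) = qPochR (Q ^ (n + 1)) Q K *
        (1 - Q ^ (n + 1) * Q ^ K) / (qPochR Q Q K * (1 - Q ^ (K + 1))) *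
          Q ^ ((n + 1) * (K + 1) + (K + 1) ^ 2) / (D * schurFactor Q s (n + 1 + K)) := by
      rw [schurTerm, d2, e2, e4]
    have t3 : Q ^ (n + 1) * (1 - Q ^ (n + 1)) / schurFactor Q s (n + 1) * schurTerm Q s (n + 2) K =
        Q ^ (n + 1) * (qPochR (Q ^ (n + 1)) Q K * (1 - Q ^ (n + 1) * Q ^ K)) / qPochR Q Q K *
          Q ^ ((n + 2) * K + K ^ 2) / (D * schurFactor Q s (n + 1 + K)) := by
      have := hδ (n + 1)
      rw [schurTerm, d3, e3]; field_simp
    have t4 : schurTerm Q s (n + 1) K = qPochR (Q ^ (n + 1)) Q K / qPochR Q Q K *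
        Q ^ ((n + 1) * K + K ^ 2) / D := rfl
    have key : schurFactor Q s n * schurTerm Q s n (K + 1)
        - (1 + s * Q ^ n) * schurTerm Q s (n + 1) (K + 1)
        - Q ^ (n + 1) * (1 - Q ^ (n + 1)) / schurFactor Q s (n + 1) * schurTerm Q s (n + 2) K
        = Q ^ (2 * n + (K + 1) + 1) * schurTerm Q s (n + 1) (K + 1)
          - Q ^ (2 * n + K + 1) * schurTerm Q s (n + 1) K := by
      rw [t1, t2, t3, t4]
      have h4 := hδ (n + 1 + K)
      generalize hδ' : schurFactor Q s (n + 1 + K) = δ at *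
      have hδ'' : δ = 1 + s * (Q ^ n * Q ^ K * Q) + (Q ^ n * Q ^ K) ^ 2 * Q ^ 3 := by
        rw [← hδ', schurFactor]; ring
      rw [show Q ^ (n * (K + 1) + (K + 1) ^ 2) =
            Q ^ (n * K + K ^ 2) * (Q ^ n * (Q ^ K) ^ 2 * Q) by ring,
        show Q ^ ((n + 1) * (K + 1) + (K + 1) ^ 2) =
            Q ^ (n * K + K ^ 2) * (Q ^ n * (Q ^ K) ^ 3 * Q ^ 2) by ring,
        show Q ^ ((n + 2) * K + K ^ 2) = Q ^ (n * K + K ^ 2) * (Q ^ K) ^ 2 by ring,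
        show Q ^ ((n + 1) * K + K ^ 2) = Q ^ (n * K + K ^ 2) * Q ^ K by ring,
        show Q ^ (2 * n + (K + 1) + 1) = (Q ^ n) ^ 2 * Q ^ K * Q ^ 2 by ring,
        show Q ^ (2 * n + K + 1) = (Q ^ n) ^ 2 * Q ^ K * Q by ring]
      rw [pow_succ Q K] at p1 ⊢
      rw [pow_succ Q n]
      generalize Q ^ (n * K + K ^ 2) = M
      generalize qPochR (Q ^ n * Q) Q K = β
      generalize Q ^ n = z at *
      generalize Q ^ K = u at *
      field_simp
      rw [hδ'']
      ring
    linear_combination ih + key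

lemma schurSeries_recurrence (hQ0 : 0 < Q) (hQ1 : Q < 1) (hs : 0 ≤ s) (n : ℕ) :
    schurFactor Q s n * schurSeries Q s n = (1 + s * Q ^ n) * schurSeries Q s (n + 1) +
      Q ^ (n + 1) * (1 - Q ^ (n + 1)) / schurFactor Q s (n + 1) * schurSeries Q s (n + 2) := by
  have S := fun n => (summable_schurTerm hQ0 hQ1 hs n).hasSum
  have l1 := ((((S n).mul_left (schurFactor Q s n)).sub
    ((S (n + 1)).mul_left (1 + s * Q ^ n))).tendsto_sum_nat.comp (tendsto_add_atTop_nat 1)).sub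
    ((S (n + 2)).tendsto_sum_nat.const_mul
      (Q ^ (n + 1) * (1 - Q ^ (n + 1)) / schurFactor Q s (n + 1)))
  have l2 : Tendsto (fun K : ℕ => Q ^ (2 * n + K + 1) * schurTerm Q s (n + 1) K) atTop (𝓝 0) := by
    refine squeeze_zero
      (fun K => mul_nonneg (by positivity) (schurTerm_nonneg hQ0 hQ1 hs _ _))
      (fun K => mul_le_of_le_one_left (schurTerm_nonneg hQ0 hQ1 hs _ _)
        (pow_le_one₀ hQ0.le hQ1.le))
      (summable_schurTerm hQ0 hQ1 hs (n + 1)).tendsto_atTop_zero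
  have := tendsto_nhds_unique (l1.congr fun K => sum_schurTerm_recurrence hQ0 hQ1 hs n K) l2
  unfold schurSeries
  linarith

lemma schurSeries_one {x : ℝ} (hx : 0 < x) (hQ0 : 0 < Q) (hQ1 : Q < 1) :
    schurSeries Q (x + Q / x) 1 = (1 + x) * (1 + Q / x) * g3R (-x) Q := by
  unfold schurSeries g3R
  rw [← tsum_mul_left]
  refine tsum_congr fun k => ?_
  have h1 := (qPochR_self_pos hQ0 hQ1 k).ne'
  have hprod : ∏ j ∈ Finset.range k, schurFactor Q (x + Q / x) (1 + j) =
      qPochR (-x * Q) Q k * qPochR ((-x)⁻¹ * Q * Q) Q k := by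
    simp only [qPochR]
    rw [← Finset.prod_mul_distrib]
    refine Finset.prod_congr rfl fun j _ => ?_
    rw [schurFactor]
    field_simp
    ring
  have h3 : qPochR (-x * Q) Q k ≠ 0 := Finset.prod_ne_zero_iff.2 fun j _ => by
    have : 0 < x * Q * Q ^ j := by positivity
    linarith
  have h4 : qPochR ((-x)⁻¹ * Q * Q) Q k ≠ 0 := Finset.prod_ne_zero_iff.2 fun j _ => by
    have : 0 < x⁻¹ * Q * Q * Q ^ j := by positivity
    rw [inv_neg]
    linarith
  have h5 : 1 + x ≠ 0 := by positivity
  have h6 : 1 + Q / x ≠ 0 := by positivity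
  rw [schurTerm, hprod, pow_one, qPochR_succ_left, qPochR_succ_left, div_self h1,
    show 1 - (-x)⁻¹ * Q = 1 + Q / x by rw [inv_neg]; ring, sub_neg_eq_add,
    show 1 * k + k ^ 2 = k * (k + 1) by ring]
  field_simp

end Analysis

section Probability

variable {Ω : Type*}

/-- The Schur gap condition between the consecutive blocks `n` and `n + 1`. -/
def gapCond (a b c : ℕ → Set Ω) (n : ℕ) : Set Ω :=
  {ω | (ω ∈ a n → ω ∉ b n ∧ ω ∉ c n) ∧ (ω ∈ b n → ω ∉ c n ∧ ω ∉ a (n + 1)) ∧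
    (ω ∈ c n → ω ∉ a (n + 1) ∧ ω ∉ b (n + 1) ∧ ω ∉ c (n + 1))}

/-- The Schur gap conditions from block `n` on. -/
def gapTail (a b c : ℕ → Set Ω) (n : ℕ) : Set Ω := ⋂ m : ℕ, gapCond a b c (n + m)

lemma gapTail_eq_inter (a b c : ℕ → Set Ω) (n : ℕ) :
    gapTail a b c n = gapCond a b c n ∩ gapTail a b c (n + 1) := by
  ext ω
  simp only [gapTail, Set.mem_inter_iff, Set.mem_iInter]
  constructor
  · intro h
    refine ⟨h 0, fun m => ?_⟩
    have := h (m + 1)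
    rwa [show n + (m + 1) = n + 1 + m by omega] at this
  · rintro ⟨h0, h⟩ m
    cases m with
    | zero => exact h0
    | succ m =>
      rw [show n + (m + 1) = n + 1 + m by omega]
      exact h m

lemma measurableSet_gapTail [MeasurableSpace Ω] {a b c : ℕ → Set Ω} {n : ℕ}
    (ha : ∀ m, n ≤ m → MeasurableSet (a m)) (hb : ∀ m, n ≤ m → MeasurableSet (b m))
    (hc : ∀ m, n ≤ m → MeasurableSet (c m)) : MeasurableSet (gapTail a b c n) := by
  refine MeasurableSet.iInter fun m => ?_
  have h1 := ha (n + m) (by omega)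
  have h2 := hb (n + m) (by omega)
  have h3 := hc (n + m) (by omega)
  have h4 := ha (n + m + 1) (by omega)
  have h5 := hb (n + m + 1) (by omega)
  have h6 := hc (n + m + 1) (by omega)
  have : gapCond a b c (n + m) =
      ((a (n + m))ᶜ ∪ ((b (n + m))ᶜ ∩ (c (n + m))ᶜ)) ∩
      (((b (n + m))ᶜ ∪ ((c (n + m))ᶜ ∩ (a (n + m + 1))ᶜ)) ∩
      ((c (n + m))ᶜ ∪ ((a (n + m + 1))ᶜ ∩ ((b (n + m + 1))ᶜ ∩ (c (n + m + 1))ᶜ)))) := by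
    ext ω
    simp only [gapCond, Set.mem_ofPred_eq, Set.mem_inter_iff, Set.mem_union, Set.mem_compl_iff,
      imp_iff_not_or]
  rw [this]
  measurability

/-- The σ-algebra generated by the events `E j` with `i ≤ j`. -/
@[reducible]
def tailFrom (E : ℕ → Set Ω) (i : ℕ) : MeasurableSpace Ω :=
  ⨆ j ∈ Set.Ici i, MeasurableSpace.generateFrom {E j}

lemma tailFrom_anti (E : ℕ → Set Ω) {i j : ℕ} (h : i ≤ j) : tailFrom E j ≤ tailFrom E i :=
  biSup_mono fun _ hk => le_trans h hk

lemma measurableSet_tailFrom (E : ℕ → Set Ω) {i j : ℕ} (h : i ≤ j) :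
    MeasurableSet[tailFrom E i] (E j) :=
  le_biSup (fun j => MeasurableSpace.generateFrom {E j}) (show j ∈ Set.Ici i from h) _
    (MeasurableSpace.measurableSet_generateFrom rfl)

variable [MeasurableSpace Ω] {μ : Measure Ω} {E : ℕ → Set Ω}

lemma tailFrom_le (hmeas : ∀ j, MeasurableSet (E j)) (i : ℕ) :
    tailFrom E i ≤ ‹MeasurableSpace Ω› :=
  iSup₂_le fun j _ => MeasurableSpace.generateFrom_le (by rintro _ rfl; exact hmeas j)

lemma measureReal_inter_tail (hmeas : ∀ j, MeasurableSet (E j)) (hindep : iIndepSet E μ)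
    (i : ℕ) {Y : Set Ω} (hY : MeasurableSet[tailFrom E (i + 1)] Y) :
    μ.real (E i ∩ Y) = μ.real (E i) * μ.real Y := by
  have h := indep_iSup_of_disjoint (S := {i}) (T := Set.Ici (i + 1))
    (fun j => MeasurableSpace.generateFrom_le (by rintro _ rfl; exact hmeas j)) hindep
    (by simp)
  have h' := (Indep_iff _ _ μ).1 h (E i) Y
    (by
      rw [iSup_singleton]
      exact MeasurableSpace.measurableSet_generateFrom rfl) hY
  rw [measureReal_def, h', ENNReal.toReal_mul]; rfl

variable {q : ℝ} [IsProbabilityMeasure μ]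

lemma measureReal_inter_of_odds (hq0 : 0 < q) (hmeas : ∀ j, MeasurableSet (E j))
    (hindep : iIndepSet E μ)
    (hprob : ∀ j, 1 ≤ j → μ (E j) = ENNReal.ofReal (q ^ j / (1 + q ^ j)))
    {i : ℕ} (hi : 1 ≤ i) {Y : Set Ω} (hY : MeasurableSet[tailFrom E (i + 1)] Y) :
    μ.real (E i ∩ Y) = q ^ i / (1 + q ^ i) * μ.real Y ∧
    μ.real ((E i)ᶜ ∩ Y) = 1 / (1 + q ^ i) * μ.real Y := by
  have h1 : μ.real (E i ∩ Y) = q ^ i / (1 + q ^ i) * μ.real Y := by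
    rw [measureReal_inter_tail hmeas hindep i hY, measureReal_def, hprob i hi,
      ENNReal.toReal_ofReal (by positivity)]
  refine ⟨h1, ?_⟩
  have h2 := measureReal_inter_add_sdiff (μ := μ) (s := Y) (hmeas i)
  rw [Set.inter_comm, h1, Set.sdiff_eq, Set.inter_comm Y] at h2
  have : 1 + q ^ i ≠ 0 := by positivity
  rw [← sub_eq_iff_eq_add'.2 h2.symm]
  field_simp
  ring

/-- Probabilities of the admissible patterns of a block of three indices, jointly with a later
event. -/
lemma measureReal_block (hq0 : 0 < q) (hmeas : ∀ j, MeasurableSet (E j))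
    (hindep : iIndepSet E μ)
    (hprob : ∀ j, 1 ≤ j → μ (E j) = ENNReal.ofReal (q ^ j / (1 + q ^ j)))
    {i j k : ℕ} (hi : 1 ≤ i) (hij : i < j) (hjk : j < k) {Y : Set Ω}
    (hY : MeasurableSet[tailFrom E (k + 1)] Y) :
    μ.real ((E i)ᶜ ∩ ((E j)ᶜ ∩ ((E k)ᶜ ∩ Y))) =
      μ.real Y / ((1 + q ^ i) * (1 + q ^ j) * (1 + q ^ k)) ∧
    μ.real (E i ∩ ((E j)ᶜ ∩ ((E k)ᶜ ∩ Y))) =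
      q ^ i * μ.real Y / ((1 + q ^ i) * (1 + q ^ j) * (1 + q ^ k)) ∧
    μ.real ((E i)ᶜ ∩ (E j ∩ ((E k)ᶜ ∩ Y))) =
      q ^ j * μ.real Y / ((1 + q ^ i) * (1 + q ^ j) * (1 + q ^ k)) ∧
    μ.real ((E i)ᶜ ∩ ((E j)ᶜ ∩ (E k ∩ Y))) =
      q ^ k * μ.real Y / ((1 + q ^ i) * (1 + q ^ j) * (1 + q ^ k)) := by
  have pr := fun {l : ℕ} (hl : 1 ≤ l) {Z : Set Ω} (hZ : MeasurableSet[tailFrom E (l + 1)] Z) =>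
    measureReal_inter_of_odds hq0 hmeas hindep hprob hl hZ
  have ek := measurableSet_tailFrom E (show j + 1 ≤ k by omega)
  have ej := measurableSet_tailFrom E (show i + 1 ≤ j by omega)
  have hYj := tailFrom_anti E (show j + 1 ≤ k + 1 by omega) _ hY
  have hji := tailFrom_anti E (show i + 1 ≤ j + 1 by omega)
  have k1 : MeasurableSet[tailFrom E (j + 1)] (E k ∩ Y) := .inter ek hYj
  have k0 : MeasurableSet[tailFrom E (j + 1)] ((E k)ᶜ ∩ Y) := .inter ek.compl hYj
  have j00 : MeasurableSet[tailFrom E (i + 1)] ((E j)ᶜ ∩ ((E k)ᶜ ∩ Y)) :=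
    .inter ej.compl (hji _ k0)
  have j10 : MeasurableSet[tailFrom E (i + 1)] (E j ∩ ((E k)ᶜ ∩ Y)) := .inter ej (hji _ k0)
  have j01 : MeasurableSet[tailFrom E (i + 1)] ((E j)ᶜ ∩ (E k ∩ Y)) :=
    .inter ej.compl (hji _ k1)
  have hj : 1 ≤ j := by omega
  have hk : 1 ≤ k := by omega
  refine ⟨?_, ?_, ?_, ?_⟩
  · rw [(pr hi j00).2, (pr hj k0).2, (pr hk hY).2]; field_simp
  · rw [(pr hi j00).1, (pr hj k0).2, (pr hk hY).2]; field_simp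
  · rw [(pr hi j10).2, (pr hj k0).1, (pr hk hY).2]; field_simp
  · rw [(pr hi j01).2, (pr hj k1).2, (pr hk hY).1]; field_simp

lemma measureReal_gapTail_recurrence {d r : ℕ} (hq0 : 0 < q) (hmeas : ∀ j, MeasurableSet (E j))
    (hindep : iIndepSet E μ)
    (hprob : ∀ j, 1 ≤ j → μ (E j) = ENNReal.ofReal (q ^ j / (1 + q ^ j)))
    (hr1 : 1 ≤ r) (hr2 : 2 * r < d) {p : ℕ → ℝ}
    (hp : ∀ n, p n = μ.real (gapTail (fun n => E (n * d + r)) (fun n => E (n * d + (d - r)))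
      (fun n => E ((n + 1) * d)) n)) (n : ℕ) :
    (1 + q ^ (n * d + r)) * (1 + q ^ (n * d + (d - r))) * (1 + q ^ ((n + 1) * d)) * p n =
      (1 + q ^ (n * d + r) + q ^ (n * d + (d - r))) * p (n + 1) +
      (q ^ ((n + 1) * d) - q ^ (n * d + (d - r)) * q ^ ((n + 1) * d + r)) /
        ((1 + q ^ ((n + 1) * d + r)) * (1 + q ^ ((n + 1) * d + (d - r))) *
          (1 + q ^ ((n + 2) * d))) * p (n + 2) := by
  set a : ℕ → Set Ω := fun n => E (n * d + r)
  set b : ℕ → Set Ω := fun n => E (n * d + (d - r))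
  set c : ℕ → Set Ω := fun n => E ((n + 1) * d)
  set C := gapTail a b c with hC
  have hCm : ∀ n, MeasurableSet[tailFrom E (n * d + 1)] (C n) := by
    intro n
    have hle : ∀ m, n ≤ m → n * d ≤ m * d := fun m h => Nat.mul_le_mul_right d h
    refine @measurableSet_gapTail _ (tailFrom E (n * d + 1)) _ _ _ _ ?_ ?_ ?_ <;> intro m hm <;>
      refine measurableSet_tailFrom E ?_ <;> have := hle m hm
    · omega
    · omega
    · rw [add_mul]; omega
  have pat := fun m {Y : Set Ω} (hY : MeasurableSet[tailFrom E ((m + 1) * d + 1)] Y) =>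
    measureReal_block hq0 hmeas hindep hprob (show 1 ≤ m * d + r by omega)
      (show m * d + r < m * d + (d - r) by omega)
      (show m * d + (d - r) < (m + 1) * d by rw [add_mul]; omega) hY
  have split : ∀ (i : ℕ) (Y : Set Ω), μ.real Y = μ.real (E i ∩ Y) + μ.real ((E i)ᶜ ∩ Y) := by
    intro i Y
    rw [Set.inter_comm, Set.inter_comm (E i)ᶜ, ← Set.sdiff_eq,
      measureReal_inter_add_sdiff (hmeas i)]
  have e0 : ∀ ω, ω ∈ C n ↔ ω ∈ gapCond a b c n ∧ ω ∈ C (n + 1) := fun ω => by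
    rw [hC, gapTail_eq_inter]; rfl
  have e1 : ∀ ω, ω ∈ C (n + 1) ↔ ω ∈ gapCond a b c (n + 1) ∧ ω ∈ C (n + 2) := fun ω => by
    rw [hC, gapTail_eq_inter a b c (n + 1)]; rfl
  simp only [gapCond, Set.mem_ofPred_eq] at e0 e1
  have s1 : a n ∩ C n = a n ∩ ((b n)ᶜ ∩ ((c n)ᶜ ∩ C (n + 1))) := by
    ext ω
    have := e0 ω
    simp only [Set.mem_inter_iff, Set.mem_compl_iff]; tauto
  have s2 : b n ∩ ((a n)ᶜ ∩ C n) =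
      (a n)ᶜ ∩ (b n ∩ ((c n)ᶜ ∩ ((a (n + 1))ᶜ ∩ C (n + 1)))) := by
    ext ω
    have := e0 ω
    simp only [Set.mem_inter_iff, Set.mem_compl_iff]; tauto
  have s3 : c n ∩ ((b n)ᶜ ∩ ((a n)ᶜ ∩ C n)) = (a n)ᶜ ∩ ((b n)ᶜ ∩ (c n ∩
      ((a (n + 1))ᶜ ∩ ((b (n + 1))ᶜ ∩ ((c (n + 1))ᶜ ∩ C (n + 1)))))) := by
    ext ω
    have := e0 ω
    simp only [Set.mem_inter_iff, Set.mem_compl_iff]; tauto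
  have s4 : (c n)ᶜ ∩ ((b n)ᶜ ∩ ((a n)ᶜ ∩ C n)) =
      (a n)ᶜ ∩ ((b n)ᶜ ∩ ((c n)ᶜ ∩ C (n + 1))) := by
    ext ω
    have := e0 ω
    simp only [Set.mem_inter_iff, Set.mem_compl_iff]; tauto
  have s5 : a (n + 1) ∩ C (n + 1) =
      a (n + 1) ∩ ((b (n + 1))ᶜ ∩ ((c (n + 1))ᶜ ∩ C (n + 2))) := by
    ext ω
    have := e1 ω
    simp only [Set.mem_inter_iff, Set.mem_compl_iff]; tauto
  have s6 : (a (n + 1))ᶜ ∩ ((b (n + 1))ᶜ ∩ ((c (n + 1))ᶜ ∩ C (n + 1))) =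
      (a (n + 1))ᶜ ∩ ((b (n + 1))ᶜ ∩ ((c (n + 1))ᶜ ∩ C (n + 2))) := by
    ext ω
    have := e1 ω
    simp only [Set.mem_inter_iff, Set.mem_compl_iff]; tauto
  have l1 : (n + 1 + 1) * d = (n + 1) * d + d := by ring
  have ma := measurableSet_tailFrom E (show (n + 1) * d + 1 ≤ (n + 1) * d + r by omega)
  have mb := measurableSet_tailFrom E (show (n + 1) * d + 1 ≤ (n + 1) * d + (d - r) by omega)
  have mc := measurableSet_tailFrom E (show (n + 1) * d + 1 ≤ (n + 1 + 1) * d by omega)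
  have f1 := (congrArg μ.real s1).trans
    (pat n (hCm (n + 1))).2.1
  have f2 := (congrArg μ.real s2).trans
    (pat n (.inter ma.compl (hCm (n + 1)))).2.2.1
  have f3 := (congrArg μ.real s3).trans
    (pat n (.inter ma.compl (.inter mb.compl (.inter mc.compl (hCm (n + 1)))))).2.2.2
  have f4 := (congrArg μ.real s4).trans
    (pat n (hCm (n + 1))).1
  have f5 := (congrArg μ.real s5).trans
    (pat (n + 1) (hCm (n + 2))).2.1
  have f6 := (congrArg μ.real s6).trans
    (pat (n + 1) (hCm (n + 2))).1
  have m0 : μ.real (C n) = μ.real (a n ∩ C n) + μ.real ((a n)ᶜ ∩ C n) := split _ _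
  have m1 : μ.real ((a n)ᶜ ∩ C n) = μ.real (b n ∩ ((a n)ᶜ ∩ C n)) +
      μ.real ((b n)ᶜ ∩ ((a n)ᶜ ∩ C n)) := split _ _
  have m2 : μ.real ((b n)ᶜ ∩ ((a n)ᶜ ∩ C n)) = μ.real (c n ∩ ((b n)ᶜ ∩ ((a n)ᶜ ∩ C n))) +
      μ.real ((c n)ᶜ ∩ ((b n)ᶜ ∩ ((a n)ᶜ ∩ C n))) := split _ _
  have m3 : μ.real ((a (n + 1))ᶜ ∩ C (n + 1)) =
      μ.real (C (n + 1)) - μ.real (a (n + 1) ∩ C (n + 1)) :=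
    eq_sub_of_add_eq' (split _ _).symm
  change _ = q ^ _ * μ.real ((a (n + 1))ᶜ ∩ C (n + 1)) / _ at f2
  change _ = q ^ _ * μ.real
    ((a (n + 1))ᶜ ∩ ((b (n + 1))ᶜ ∩ ((c (n + 1))ᶜ ∩ C (n + 1)))) / _ at f3
  rw [m3, f5] at f2
  rw [f6] at f3
  rw [hp n, hp (n + 1), hp (n + 2), m0, m1, m2, f1, f2, f3, f4, show n + 1 + 1 = n + 2 from rfl]
  have o : ∀ m : ℕ, 1 + q ^ m ≠ 0 := fun m => by positivity
  have o1 := o (n * d + r)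
  have o2 := o (n * d + (d - r))
  have o3 := o ((n + 1) * d)
  have o4 := o ((n + 1) * d + r)
  have o5 := o ((n + 1) * d + (d - r))
  have o6 := o ((n + 2) * d)
  clear f1 f2 f3 f4 f5 f6 m0 m1 m2 m3 o
  generalize q ^ (n * d + r) = x1 at *
  generalize q ^ (n * d + (d - r)) = x2 at *
  generalize q ^ ((n + 1) * d) = x3 at *
  generalize q ^ ((n + 1) * d + r) = x4 at *
  generalize q ^ ((n + 1) * d + (d - r)) = x5 at *
  generalize q ^ ((n + 2) * d) = x6 at *
  field_simp
  ring

lemma exists_measureReal_gapTail_pos {d r : ℕ} (hq0 : 0 < q) (hq1 : q < 1)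
    (hmeas : ∀ j, MeasurableSet (E j))
    (hprob : ∀ j, 1 ≤ j → μ (E j) = ENNReal.ofReal (q ^ j / (1 + q ^ j)))
    (hr1 : 1 ≤ r) (hr2 : 2 * r < d) :
    ∃ n, 0 < μ.real (gapTail (fun n => E (n * d + r)) (fun n => E (n * d + (d - r)))
      (fun n => E ((n + 1) * d)) (n + 1)) := by
  obtain ⟨N, hN⟩ : ∃ N, μ (⋃ j, E (j + N)) < 1 := by
    have hfin : ∑' j, μ (E j) ≠ ⊤ := by
      have h1 : ∀ j, μ (E j) ≤ (if j = 0 then 1 else 0) + ENNReal.ofReal (q ^ j) := by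
        intro j
        rcases Nat.eq_zero_or_pos j with rfl | hj
        · simpa using prob_le_one.trans (le_add_right le_rfl)
        · rw [hprob j hj]
          refine le_add_left (ENNReal.ofReal_le_ofReal (div_le_self (by positivity) ?_))
          have := pow_pos hq0 j
          linarith
      refine ne_top_of_le_ne_top ?_ (ENNReal.tsum_le_tsum h1)
      rw [ENNReal.tsum_add]
      refine ENNReal.add_ne_top.2 ⟨by simp, ?_⟩
      rw [← ENNReal.ofReal_tsum_of_nonneg (fun j => by positivity)
        (summable_geometric_of_lt_one hq0.le hq1)]
      exact ENNReal.ofReal_ne_top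
    have := ENNReal.tendsto_sum_nat_add (fun j => μ (E j)) hfin
    obtain ⟨N, hN⟩ := (this.eventually_lt_const one_pos).exists
    exact ⟨N, (measure_iUnion_le _).trans_lt hN⟩
  refine ⟨N, ?_⟩
  have hsub : (⋃ j, E (j + N))ᶜ ⊆ gapTail (fun n => E (n * d + r))
      (fun n => E (n * d + (d - r))) (fun n => E ((n + 1) * d)) (N + 1) := by
    intro ω hω
    have hno : ∀ j, N ≤ j → ω ∉ E j := fun j hj h =>
      hω (Set.mem_iUnion.2 ⟨j - N, by rwa [Nat.sub_add_cancel hj]⟩)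
    refine Set.mem_iInter.2 fun m => ?_
    have hle : N + 1 + m ≤ (N + 1 + m) * d := Nat.le_mul_of_pos_right _ (by omega)
    have hle' : N + 1 + m ≤ (N + 1 + m + 1) * d := by rw [add_mul]; omega
    exact ⟨fun h => absurd h (hno _ (by omega)), fun h => absurd h (hno _ (by omega)),
      fun h => absurd h (hno _ (by omega))⟩
  have hm : MeasurableSet (⋃ j, E (j + N)) := .iUnion fun j => hmeas _
  refine lt_of_lt_of_le ?_ (measureReal_mono hsub)
  rw [probReal_compl_eq_one_sub hm]
  have : μ.real (⋃ j, E (j + N)) < 1 := by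
    rw [measureReal_def, ← ENNReal.toReal_one]
    exact (ENNReal.toReal_lt_toReal (measure_ne_top _ _) ENNReal.one_ne_top).2 hN
  linarith

end Probability

/-- With `(E_j)_{j≥1}` independent events of probability `q^j/(1+q^j)`, `U_{d,r}` the
gap-condition event over all `n ≥ 0` and `V_{d,r}` the same event but only over `n ≥ 1`
(no restriction on `E_r`, `E_{d-r}`, `E_d`):
`P(U_{d,r} | V_{d,r}) = 1/((1+q^r)(1+q^{d-r})(1+q^d) g₃(-q^r; q^d))`. -/
theorem cond_prob_U_given_V {Ω : Type*} [MeasurableSpace Ω] (μ : Measure Ω)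
    [IsProbabilityMeasure μ]
    (q : ℝ) (hq0 : 0 < q) (hq1 : q < 1)
    (E : ℕ → Set Ω) (hmeas : ∀ j, MeasurableSet (E j))
    (hindep : ProbabilityTheory.iIndepSet E μ)
    (hprob : ∀ j, 1 ≤ j → μ (E j) = ENNReal.ofReal (q ^ j / (1 + q ^ j)))
    (d r : ℕ) (hd : 3 ≤ d) (hr1 : 1 ≤ r) (hr2 : 2 * r < d)
    (U V : Set Ω)
    (hU : U = ⋂ n : ℕ, {ω : Ω |
      (ω ∈ E (n * d + r) → ω ∉ E (n * d + (d - r)) ∧ ω ∉ E ((n + 1) * d)) ∧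
      (ω ∈ E (n * d + (d - r)) → ω ∉ E ((n + 1) * d) ∧ ω ∉ E ((n + 1) * d + r)) ∧
      (ω ∈ E ((n + 1) * d) → ω ∉ E ((n + 1) * d + r) ∧ ω ∉ E ((n + 1) * d + (d - r)) ∧
        ω ∉ E ((n + 2) * d))})
    (hV : V = ⋂ n : ℕ, {ω : Ω |
      (ω ∈ E ((n + 1) * d + r) → ω ∉ E ((n + 1) * d + (d - r)) ∧ ω ∉ E ((n + 2) * d)) ∧
      (ω ∈ E ((n + 1) * d + (d - r)) → ω ∉ E ((n + 2) * d) ∧ ω ∉ E ((n + 2) * d + r)) ∧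
      (ω ∈ E ((n + 2) * d) → ω ∉ E ((n + 2) * d + r) ∧ ω ∉ E ((n + 2) * d + (d - r)) ∧
        ω ∉ E ((n + 3) * d))}) :
    ProbabilityTheory.cond μ V U =
      ENNReal.ofReal
        (1 / ((1 + q ^ r) * (1 + q ^ (d - r)) * (1 + q ^ d) * g3R (-q ^ r) (q ^ d))) := by
  set a : ℕ → Set Ω := fun n => E (n * d + r)
  set b : ℕ → Set Ω := fun n => E (n * d + (d - r))
  set c : ℕ → Set Ω := fun n => E ((n + 1) * d)
  have hU' : U = gapTail a b c 0 := by
    rw [hU, gapTail]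
    exact Set.iInter_congr fun n => by rw [zero_add]; rfl
  have hV' : V = gapTail a b c 1 := by
    rw [hV, gapTail]
    exact Set.iInter_congr fun n => by rw [add_comm 1 n]; rfl
  have hUV : U ⊆ V := by
    rw [hU', hV', gapTail_eq_inter]
    exact Set.inter_subset_right
  obtain ⟨p, hp⟩ : ∃ p : ℕ → ℝ, ∀ n, p n = μ.real (gapTail a b c n) := ⟨_, fun _ => rfl⟩
  have hp0 : ∀ n, 0 ≤ p n := fun n => by rw [hp]; exact measureReal_nonneg
  have hp1 : ∀ n, p n ≤ 1 := fun n => by rw [hp]; exact measureReal_le_one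
  have hrec := measureReal_gapTail_recurrence hq0 hmeas hindep hprob hr1 hr2 hp
  set Q := q ^ d
  set x := q ^ r
  have hQ0 : 0 < Q := by positivity
  have hQ1 : Q < 1 := pow_lt_one₀ hq0.le hq1 (by omega)
  have hx0 : 0 < x := by positivity
  have hy : q ^ (d - r) = Q / x := by
    rw [eq_div_iff hx0.ne', ← pow_add, Nat.sub_add_cancel (by omega)]
  have hy0 : 0 < Q / x := by positivity
  have hs : 0 ≤ x + Q / x := by positivity
  have E1 : ∀ n, q ^ (n * d + r) = x * Q ^ n := fun n => by
    rw [pow_add, mul_comm n d, pow_mul, mul_comm]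
  have E2 : ∀ n, q ^ (n * d + (d - r)) = Q / x * Q ^ n := fun n => by
    rw [pow_add, mul_comm n d, pow_mul, mul_comm, hy]
  have E3 : ∀ n, q ^ (n * d) = Q ^ n := fun n => by rw [mul_comm n d, pow_mul]
  have hfac : ∀ n, (1 + x * Q ^ n) * (1 + Q / x * Q ^ n) = schurFactor Q (x + Q / x) n :=
    fun n => by
      rw [schurFactor]
      field_simp
      ring
  have hδ1 := fun n => one_le_schurFactor hQ0 hs n
  have hδ0 : ∀ n, 0 < schurFactor Q (x + Q / x) n := fun n => one_pos.trans_le (hδ1 n)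
  have hpow : ∀ n, 0 < Q ^ n := fun n => pow_pos hQ0 n
  have hrec' : ∀ n, schurFactor Q (x + Q / x) n * (1 + Q ^ (n + 1)) * p n =
      (1 + (x + Q / x) * Q ^ n) * p (n + 1) + Q ^ (n + 1) * (1 - Q ^ (n + 1)) /
        (schurFactor Q (x + Q / x) (n + 1) * (1 + Q ^ (n + 2))) * p (n + 2) := fun n => by
    have h := hrec n
    simp only [E1, E2, E3, hfac] at h
    rw [h, show Q / x * Q ^ n * (x * Q ^ (n + 1)) = Q ^ (n + 1) * Q ^ (n + 1) by
      field_simp; ring]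
    ring
  -- positivity of all tail probabilities
  have hcoef : ∀ n, 0 ≤ Q ^ (n + 1) * (1 - Q ^ (n + 1)) := fun n =>
    mul_nonneg (hpow _).le (sub_nonneg.2 (pow_le_one₀ hQ0.le hQ1.le))
  have hdesc : ∀ n, 0 < p (n + 1) → 0 < p n := by
    intro n hn
    by_contra hcon
    have hz : p n = 0 := le_antisymm (not_lt.1 hcon) (hp0 n)
    have h := hrec' n
    rw [hz, mul_zero] at h
    have h1 : 0 < (1 + (x + Q / x) * Q ^ n) * p (n + 1) := by
      have := hpow n
      positivity
    have h2 : 0 ≤ Q ^ (n + 1) * (1 - Q ^ (n + 1)) /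
        (schurFactor Q (x + Q / x) (n + 1) * (1 + Q ^ (n + 2))) * p (n + 2) :=
      mul_nonneg (div_nonneg (hcoef n)
        (mul_nonneg (hδ0 _).le (by have := hpow (n + 2); linarith))) (hp0 _)
    linarith
  have hpos : 0 < p 1 := by
    obtain ⟨N, hN⟩ := exists_measureReal_gapTail_pos hq0 hq1 hmeas hprob hr1 hr2
    rw [← hp] at hN
    have : ∀ m, 0 < p (m + 1) → 0 < p 1 := fun m => by
      induction m with
      | zero => exact id
      | succ m ih => exact fun h => ih (hdesc _ h)
    exact this N hN
  -- normalise so that both sequences obey the same recurrence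
  set D : ℕ → ℝ := fun n => ∏ m ∈ Finset.range n, (1 + Q ^ (m + 1)) with hD
  have hD1 : ∀ n, 1 ≤ D n := fun n =>
    Finset.prod_induction _ (fun t => (1 : ℝ) ≤ t) (fun _ _ => one_le_mul_of_one_le_of_one_le)
      le_rfl fun j _ => by have := hpow (j + 1); linarith
  have hDs : ∀ n, D (n + 1) = D n * (1 + Q ^ (n + 1)) := fun n => Finset.prod_range_succ _ _
  have hnorm : ∀ n, schurFactor Q (x + Q / x) n * (p n / D n) =
      (1 + (x + Q / x) * Q ^ n) * (p (n + 1) / D (n + 1)) +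
      Q ^ (n + 1) * (1 - Q ^ (n + 1)) / schurFactor Q (x + Q / x) (n + 1) *
        (p (n + 2) / D (n + 2)) := fun n => by
    have h1 : D n ≠ 0 := (one_pos.trans_le (hD1 n)).ne'
    have h2 : 1 + Q ^ (n + 1) ≠ 0 := by have := hpow (n + 1); positivity
    have h3 : 1 + Q ^ (n + 2) ≠ 0 := by have := hpow (n + 2); positivity
    have h4 := (hδ0 (n + 1)).ne'
    have h5 : schurFactor Q (x + Q / x) n * (p n / D n) =
        schurFactor Q (x + Q / x) n * (1 + Q ^ (n + 1)) * p n / (D n * (1 + Q ^ (n + 1))) := by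
      field_simp
    rw [h5, hrec' n, hDs (n + 1), hDs n]
    field_simp
  have hprop := bounded_solutions_proportional (h := schurSeries Q (x + Q / x))
    (p := fun n => p n / D n) (Q := Q)
    (B := max (∑' k : ℕ, Q ^ (k ^ 2) / qPochR Q Q k) 1) hQ0.le hQ1 hδ0
    (fun n => by
      rw [abs_of_nonneg (div_nonneg (hcoef n) (hδ0 _).le)]
      calc _ ≤ Q ^ (n + 1) * (1 - Q ^ (n + 1)) := div_le_self (hcoef n) (hδ1 _)
        _ ≤ Q ^ (n + 1) * 1 := by gcongr; have := hpow (n + 1); linarith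
        _ ≤ Q := by
          rw [mul_one]
          exact pow_le_of_le_one hQ0.le hQ1.le (by omega)
        _ ≤ Q * schurFactor Q (x + Q / x) n := le_mul_of_one_le_right hQ0.le (hδ1 n))
    (schurSeries_recurrence hQ0 hQ1 hs) hnorm
    (fun n => (abs_schurSeries_le hQ0 hQ1 hs n).trans (le_max_left _ _))
    (fun n => by
      rw [abs_of_nonneg (div_nonneg (hp0 n) (one_pos.trans_le (hD1 n)).le)]
      exact ((div_le_self (hp0 n) (hD1 n)).trans (hp1 n)).trans (le_max_right _ _))
  have hD0' : D 0 = 1 := by simp [hD]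
  have hD1' : D 1 = 1 + Q := by simp [hD]
  rw [schurSeries_zero, schurSeries_one hx0 hQ0 hQ1] at hprop
  simp only [hD0', hD1', one_mul, div_one] at hprop
  have hratio : p 1 = (1 + x) * (1 + Q / x) * (1 + Q) * g3R (-x) Q * p 0 := by
    rw [div_eq_iff (by positivity)] at hprop
    rw [hprop]
    ring
  have hVm : MeasurableSet V := by
    rw [hV']
    exact measurableSet_gapTail (fun _ _ => hmeas _) (fun _ _ => hmeas _) fun _ _ => hmeas _
  rw [cond_apply hVm, Set.inter_eq_self_of_subset_right hUV, hU', hV',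
    ← ENNReal.ofReal_toReal (measure_ne_top μ (gapTail a b c 0)),
    ← ENNReal.ofReal_toReal (measure_ne_top μ (gapTail a b c 1)),
    ← measureReal_def, ← measureReal_def, ← hp, ← hp, ← ENNReal.ofReal_inv_of_pos hpos,
    ← ENNReal.ofReal_mul (by positivity), hy]
  congr 1
  have h0 : p 0 ≠ 0 := fun h => by rw [h, mul_zero] at hratio; linarith
  have h1 : (1 + x) * (1 + Q / x) * (1 + Q) * g3R (-x) Q ≠ 0 := fun h => by
    rw [h, zero_mul] at hratio; linarith
  rw [hratio, mul_inv, mul_assoc, inv_mul_cancel₀ h0, mul_one, one_div]
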